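/- arXiv:1803.10991 — 4 statements merged into one kernel-verified Lean document; each statement's English description precedes it below -/
import Mathlib

section
/- Let -∞ < a < b < ∞, let f : [a,b] → ℝ be continuously differentiable and piecewise strictly monotone, and suppose f′ vanishes at only finitely many points of [a,b]. Let μ be the probability measure on [a,b] with density c ∈ L¹([a,b]) with respect to Lebesgue measure. Then the pushforward measure of μ under f has density p_f(y) = Σ_{α ∈ f⁻¹(y), f′(α) ≠ 0} c(α)/|f′(α)| with respect to Lebesgue measure on ℝ; that is, for every Borel set B ⊆ ℝ, μ(f⁻¹(B)) = ∫_B Σ_{α ∈ f⁻¹(y), f′(α) ≠ 0} c(α)/|f′(α)| dy. -/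
open MeasureTheory Set

/-- The part of the preimage of a Borel set lying in a measurable set on which the function is
continuous is measurable. -/
theorem ContinuousOn.measurableSet_inter_preimage {f : ℝ → ℝ} {s B : Set ℝ}
    (hf : ContinuousOn f s) (hs : MeasurableSet s) (hB : MeasurableSet B) :
    MeasurableSet (s ∩ f ⁻¹' B) := by
  have := hs.subtype_image (hf.domRestrict.measurable hB)
  rwa [domRestrict_eq, preimage_comp, Subtype.image_preimage_coe] at this

/-- The area formula on a single piece of injectivity, together with the measurability of the
fiber sum. -/
theorem measurable_and_setLIntegral_tsum_fiber_of_injOn {f f' : ℝ → ℝ} {s : Set ℝ}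
    {h : ℝ → ENNReal} (hs : MeasurableSet s)
    (hderiv : ∀ x ∈ s, HasDerivWithinAt f (f' x) s x) (hinj : InjOn f s)
    (hh : Measurable (s.domRestrict h)) :
    Measurable (fun y => ∑' α : ↥(s ∩ f ⁻¹' {y}), h α) ∧
      ∀ B : Set ℝ, MeasurableSet B →
        ∫⁻ y in B, ∑' α : ↥(s ∩ f ⁻¹' {y}), h α =
          ∫⁻ x in s ∩ f ⁻¹' B, ENNReal.ofReal |f' x| * h x := by
  have hcont : ContinuousOn f s := fun x hx => (hderiv x hx).continuousWithinAt
  have hemb : MeasurableEmbedding (s.domRestrict f) := hcont.measurableEmbedding hs hinj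
  have hmem : ∀ x ∈ s, ∑' α : ↥(s ∩ f ⁻¹' {f x}), h α = h x := by
    intro x hx
    have hset : s ∩ f ⁻¹' {f x} = {x} := by
      ext z
      simp only [mem_inter_iff, mem_preimage, mem_singleton_iff]
      exact ⟨fun hz => hinj hz.1 hx hz.2, by rintro rfl; exact ⟨hx, rfl⟩⟩
    rw [hset, tsum_singleton]
  have hnot : ∀ y ∉ f '' s, ∑' α : ↥(s ∩ f ⁻¹' {y}), h α = 0 := by
    intro y hy
    have hset : s ∩ f ⁻¹' {y} = ∅ := by
      ext z
      simp only [mem_inter_iff, mem_preimage, mem_singleton_iff, mem_empty_iff_false, iff_false]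
      exact fun hz => hy ⟨z, hz.1, hz.2⟩
    rw [hset, tsum_empty]
  refine ⟨?_, fun B hB => ?_⟩
  · convert hemb.measurable_extend hh (measurable_const (a := (0 : ENNReal))) using 1
    ext y
    by_cases hy : y ∈ f '' s
    · obtain ⟨x, hx, rfl⟩ := hy
      rw [hmem x hx]
      exact (hemb.injective.extend_apply (s.domRestrict h) (fun _ => 0) ⟨x, hx⟩).symm
    · rw [hnot y hy, Function.extend_apply']
      rintro ⟨x, rfl⟩
      exact hy ⟨x, x.2, rfl⟩
  · have hsB : MeasurableSet (s ∩ f ⁻¹' B) := hcont.measurableSet_inter_preimage hs hB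
    have hfs : MeasurableSet (f '' s) := by
      rw [← range_domRestrict]
      exact hemb.measurableSet_range
    calc ∫⁻ y in B, ∑' α : ↥(s ∩ f ⁻¹' {y}), h α
        = ∫⁻ y in f '' (s ∩ f ⁻¹' B), ∑' α : ↥(s ∩ f ⁻¹' {y}), h α := by
          rw [image_inter_preimage, inter_comm, ← lintegral_inter_add_sdiff _ B hfs, setLIntegral_congr_fun (hB.diff hfs)
            fun y hy => hnot y hy.2, lintegral_zero, add_zero]
      _ = ∫⁻ x in s ∩ f ⁻¹' B, ENNReal.ofReal |f' x| * ∑' α : ↥(s ∩ f ⁻¹' {f x}), h α :=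
          lintegral_image_eq_lintegral_abs_deriv_mul hsB
            (fun x hx => (hderiv x hx.1).mono inter_subset_left) (hinj.mono inter_subset_left) _
      _ = ∫⁻ x in s ∩ f ⁻¹' B, ENNReal.ofReal |f' x| * h x :=
          setLIntegral_congr_fun hsB fun x hx => by simp only [hmem x hx.1]

/-- The area formula on a countable disjoint union of pieces of injectivity. -/
theorem setLIntegral_tsum_fiber_iUnion {ι : Type*} [Countable ι] {f f' : ℝ → ℝ}
    {s : ι → Set ℝ} {h : ℝ → ENNReal} (hs : ∀ i, MeasurableSet (s i))
    (hdisj : Pairwise (Function.onFun Disjoint s))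
    (hderiv : ∀ i, ∀ x ∈ s i, HasDerivWithinAt f (f' x) (s i) x) (hinj : ∀ i, InjOn f (s i))
    (hh : ∀ i, Measurable ((s i).domRestrict h)) {B : Set ℝ} (hB : MeasurableSet B) :
    ∫⁻ y in B, ∑' α : ↥((⋃ i, s i) ∩ f ⁻¹' {y}), h α =
      ∫⁻ x in (⋃ i, s i) ∩ f ⁻¹' B, ENNReal.ofReal |f' x| * h x := by
  have key := fun i =>
    measurable_and_setLIntegral_tsum_fiber_of_injOn (hs i) (hderiv i) (hinj i) (hh i)
  have hsB : ∀ i, MeasurableSet (s i ∩ f ⁻¹' B) := fun i =>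
    ContinuousOn.measurableSet_inter_preimage
      (fun x hx => (hderiv i x hx).continuousWithinAt) (hs i) hB
  have hsum : ∀ y, ∑' α : ↥((⋃ i, s i) ∩ f ⁻¹' {y}), h α =
      ∑' i, ∑' α : ↥(s i ∩ f ⁻¹' {y}), h α := fun y => by
    rw [iUnion_inter]
    exact ENNReal.tsum_biUnion fun i _ j _ hij =>
      (hdisj hij).mono inter_subset_left inter_subset_left
  simp_rw [hsum]
  rw [lintegral_tsum fun i => (key i).1.aemeasurable, iUnion_inter, lintegral_iUnion hsB
    fun i j hij => (hdisj hij).mono inter_subset_left inter_subset_left]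
  exact tsum_congr fun i => (key i).2 B hB

/-- A point lying between the endpoints of a finite subdivision is a node or lies in one of the
open subintervals. -/
theorem exists_mem_Ioo_of_notMem_range {n : ℕ} {t : Fin (n + 1) → ℝ} {x : ℝ}
    (hx : x ∈ Icc (t 0) (t (Fin.last n))) (hxt : x ∉ range t) :
    ∃ i : Fin n, x ∈ Ioo (t i.castSucc) (t i.succ) := by
  have hne : ∀ j, t j ≠ x := fun j hj => hxt ⟨j, hj⟩
  have aux : ∀ j : Fin (n + 1), x < t j → ∃ i : Fin n, x ∈ Ioo (t i.castSucc) (t i.succ) := by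
    intro j
    induction j using Fin.induction with
    | zero => exact fun hlt => absurd hx.1 hlt.not_ge
    | succ i ih =>
      intro hlt
      rcases lt_or_ge x (t i.castSucc) with h | h
      · exact ih h
      · exact ⟨i, lt_of_le_of_ne h (hne _), hlt⟩
  exact aux _ (lt_of_le_of_ne hx.2 (hne _).symm)

/-- The PDF of a piecewise strictly monotone, continuously differentiable
quantity of interest `f` on `[a,b]`, under the measure with density `c`, is
`p_f(y) = ∑_{α ∈ f⁻¹(y), f'(α) ≠ 0} c(α) / |f'(α)|`. -/
theorem pdf_of_piecewise_monotone
    (a b : ℝ) (hab : a < b)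
    (f f' c : ℝ → ℝ)
    (hderiv : ∀ α ∈ Icc a b, HasDerivWithinAt f (f' α) (Icc a b) α)
    (hf'cont : ContinuousOn f' (Icc a b))
    (hpiecewise : ∃ (n : ℕ) (t : Fin (n + 1) → ℝ), StrictMono t ∧
      t 0 = a ∧ t (Fin.last n) = b ∧
      ∀ i : Fin n, StrictMonoOn f (Icc (t i.castSucc) (t i.succ)) ∨
        StrictAntiOn f (Icc (t i.castSucc) (t i.succ)))
    (hfin : {α ∈ Icc a b | f' α = 0}.Finite)
    (hc_nonneg : ∀ α ∈ Icc a b, 0 ≤ c α)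
    (hc_int : IntegrableOn c (Icc a b))
    (hc_prob : ∫ α in Icc a b, c α = 1)
    (μ : Measure ℝ)
    (hμ : μ = (volume.restrict (Icc a b)).withDensity (fun α => ENNReal.ofReal (c α))) :
    ∀ B : Set ℝ, MeasurableSet B →
      μ (f ⁻¹' B) = ∫⁻ y in B,
        ENNReal.ofReal (∑' α : {α : ℝ // α ∈ Icc a b ∧ f α = y ∧ f' α ≠ 0},
          c ↑α / |f' ↑α|) := by
  intro B hB
  obtain ⟨n, t, ht, ht0, htn, hmono⟩ := hpiecewise
  set s : Fin n → Set ℝ := fun i => Ioo (t i.castSucc) (t i.succ) \ {α ∈ Icc a b | f' α = 0}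
  have hsub : ∀ i : Fin n, Ioo (t i.castSucc) (t i.succ) ⊆ Icc a b := fun i x hx =>
    ⟨ht0 ▸ (ht.monotone (Fin.zero_le _)).trans hx.1.le,
      htn ▸ hx.2.le.trans (ht.monotone (Fin.le_last _))⟩
  have hsI : ∀ i, s i ⊆ Icc a b := fun i => sdiff_subset.trans (hsub i)
  have hs : ∀ i, MeasurableSet (s i) := fun i => measurableSet_Ioo.diff hfin.measurableSet
  have hne : ∀ i, ∀ x ∈ s i, f' x ≠ 0 := fun i x hx h0 => hx.2 ⟨hsI i hx, h0⟩
  have hdisj : Pairwise (Function.onFun Disjoint s) := by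
    refine (pairwise_disjoint_on s).2 fun i j hij => ?_
    refine disjoint_left.2 fun x hxi hxj => ?_
    have : t i.succ ≤ t j.castSucc := ht.monotone (Fin.le_def.2 (Nat.succ_le_of_lt hij))
    exact absurd (hxi.1.2.trans_le this) hxj.1.1.le.not_gt
  have hinj : ∀ i, InjOn f (s i) := fun i => by
    have : InjOn f (Icc (t i.castSucc) (t i.succ)) :=
      (hmono i).elim StrictMonoOn.injOn StrictAntiOn.injOn
    exact this.mono (sdiff_subset.trans Ioo_subset_Icc_self)
  have hcover : ∀ x ∈ Icc a b, f' x ≠ 0 → x ∉ range t → x ∈ ⋃ i, s i := by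
    intro x hx h0 hxt
    obtain ⟨i, hi⟩ := exists_mem_Ioo_of_notMem_range (by rwa [ht0, htn]) hxt
    exact mem_iUnion.2 ⟨i, hi, fun h => h0 h.2⟩
  obtain ⟨g, hg, hcg⟩ := hc_int.aestronglyMeasurable.aemeasurable
  set N : Set ℝ := {x ∈ Icc a b | c x ≠ g x} with hN_def
  have hN : volume N = 0 := by
    rw [Filter.EventuallyEq, ae_restrict_iff' measurableSet_Icc, ae_iff] at hcg
    simpa [hN_def, and_assoc] using hcg
  have hZ : volume (f '' (N ∪ range t ∩ Icc a b)) = 0 := by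
    refine addHaar_image_eq_zero_of_differentiableOn_of_addHaar_eq_zero volume
      (fun x hx => ?_)
      (measure_union_null hN (((finite_range t).subset inter_subset_left).measure_zero _))
    have hsubset : N ∪ range t ∩ Icc a b ⊆ Icc a b :=
      union_subset (sep_subset _ _) inter_subset_right
    exact ((hderiv x (hsubset hx)).differentiableWithinAt).mono hsubset
  set h : ℝ → ENNReal := fun x => ENNReal.ofReal (g x / |f' x|) with hh_def
  have hh : ∀ i, Measurable ((s i).domRestrict h) := fun i => by
    have h1 : Measurable ((s i).domRestrict f') := (hf'cont.mono (hsI i)).domRestrict.measurable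
    have h2 : Measurable ((s i).domRestrict g) := hg.comp measurable_subtype_coe
    exact ENNReal.measurable_ofReal.comp (h2.div h1.abs)
  have hfiber : ∀ y ∉ f '' (N ∪ range t ∩ Icc a b),
      ENNReal.ofReal (∑' α : {α : ℝ // α ∈ Icc a b ∧ f α = y ∧ f' α ≠ 0}, c ↑α / |f' ↑α|) =
        ∑' α : ↥((⋃ i, s i) ∩ f ⁻¹' {y}), h α := by
    intro y hy
    have hset : {α : ℝ | α ∈ Icc a b ∧ f α = y ∧ f' α ≠ 0} = (⋃ i, s i) ∩ f ⁻¹' {y} := by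
      ext x
      constructor
      · rintro ⟨hx, hfx, h0⟩
        exact ⟨hcover x hx h0 fun hxt => hy ⟨x, Or.inr ⟨hxt, hx⟩, hfx⟩, hfx⟩
      · rintro ⟨hx, hfx⟩
        obtain ⟨i, hi⟩ := mem_iUnion.1 hx
        exact ⟨hsI i hi, hfx, hne i x hi⟩
    have hfinite : {α : ℝ | α ∈ Icc a b ∧ f α = y ∧ f' α ≠ 0}.Finite := by
      rw [hset, iUnion_inter]
      refine finite_iUnion fun i => Set.Subsingleton.finite fun x hx z hz => ?_
      exact hinj i hx.1 hz.1 (hx.2.trans hz.2.symm)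
    have : Finite {α : ℝ // α ∈ Icc a b ∧ f α = y ∧ f' α ≠ 0} := hfinite
    rw [ENNReal.ofReal_tsum_of_nonneg
      (fun α => div_nonneg (hc_nonneg _ α.2.1) (abs_nonneg _)) Summable.of_finite]
    rw [← tsum_congr_set_coe h hset]
    refine tsum_congr fun α => ?_
    have hα : c α = g α := by
      by_contra hcon
      exact hy ⟨α, Or.inl ⟨α.2.1, hcon⟩, α.2.2.1⟩
    simp only [hh_def, hα]
  have hae : ((⋃ i, s i) ∩ f ⁻¹' B : Set ℝ) =ᵐ[volume] (f ⁻¹' B ∩ Icc a b : Set ℝ) := by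
    rw [ae_eq_set]
    refine ⟨?_, ?_⟩
    · rw [sdiff_eq_empty.2, measure_empty]
      exact fun x hx => ⟨hx.2, iUnion_subset hsI hx.1⟩
    · refine ((hfin.union (finite_range t)).subset fun x hx => ?_).measure_zero _
      by_contra hcon
      exact hx.2 ⟨hcover x hx.1.2 (fun h0 => hcon (Or.inl ⟨hx.1.2, h0⟩))
        (fun hxt => hcon (Or.inr hxt)), hx.1.1⟩
  have hUB : MeasurableSet ((⋃ i, s i) ∩ f ⁻¹' B) := by
    refine ContinuousOn.measurableSet_inter_preimage (fun x hx => ?_) (MeasurableSet.iUnion hs) hB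
    exact ((hderiv x (iUnion_subset hsI hx)).continuousWithinAt).mono (iUnion_subset hsI)
  calc μ (f ⁻¹' B)
      = ∫⁻ x in f ⁻¹' B, ENNReal.ofReal (c x) ∂(volume.restrict (Icc a b)) := by
        rw [hμ, withDensity_apply']
    _ = ∫⁻ x in f ⁻¹' B, ENNReal.ofReal (g x) ∂(volume.restrict (Icc a b)) := by
        refine lintegral_congr_ae (ae_restrict_of_ae ?_)
        filter_upwards [hcg] with x hx
        rw [hx]
    _ = ∫⁻ x in (⋃ i, s i) ∩ f ⁻¹' B, ENNReal.ofReal (g x) := by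
        rw [Measure.restrict_restrict' measurableSet_Icc, setLIntegral_congr hae]
    _ = ∫⁻ x in (⋃ i, s i) ∩ f ⁻¹' B, ENNReal.ofReal |f' x| * h x := by
        refine setLIntegral_congr_fun hUB fun x hx => ?_
        obtain ⟨i, hi⟩ := mem_iUnion.1 hx.1
        simp only [hh_def]
        rw [← ENNReal.ofReal_mul (abs_nonneg _), mul_div_cancel₀ _ (abs_ne_zero.2 (hne i x hi))]
    _ = ∫⁻ y in B, ∑' α : ↥((⋃ i, s i) ∩ f ⁻¹' {y}), h α :=
        (setLIntegral_tsum_fiber_iUnion hs hdisj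
          (fun i x hx => (hderiv x (hsI i hx)).mono (hsI i)) hinj hh hB).symm
    _ = _ := by
        refine lintegral_congr_ae (ae_restrict_of_ae ?_)
        filter_upwards [measure_eq_zero_iff_ae_notMem.1 hZ] with y hy
        exact (hfiber y hy).symm
end

section
/- For every ε > 0 there exist strictly increasing, continuously differentiable functions f, g : [0,1] → ℝ such that sup_{α ∈ [0,1]} |f(α) − g(α)| ≤ ε, the pushforward measures of Lebesgue measure on [0,1] under f and under g possess continuous densities p_f and p_g respectively, and sup_{y ∈ ℝ} |p_f(y) − p_g(y)| ≥ 1/2. (One may take f(α) = α and g(α) = α + δ·sin(α/(2δ)) for δ > 0 sufficiently small.) -/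
open MeasureTheory Set

/-- If an increasing differentiable bijection `e` of `ℝ` fixes `0` and `1`, then its inverse pushes
Lebesgue measure on `[0, 1]` forward to the measure with density `e'` on `[0, 1]`. -/
theorem OrderIso.volume_restrict_Icc_preimage_symm (e : ℝ ≃o ℝ) {e' : ℝ → ℝ}
    (he : ∀ x, HasDerivAt e (e' x) x) (h0 : e 0 = 0) (h1 : e 1 = 1) {B : Set ℝ}
    (hB : MeasurableSet B) :
    (volume.restrict (Icc (0 : ℝ) 1)) (e.symm ⁻¹' B) =
      ∫⁻ y in B, ENNReal.ofReal ((Icc (0 : ℝ) 1).indicator e' y) := by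
  have hpre : e.symm ⁻¹' B ∩ Icc 0 1 = e '' (Icc 0 1 ∩ B) := by
    rw [image_inter e.injective, OrderIso.image_Icc, h0, h1, inter_comm]
    congr 1
    exact (e.toEquiv.image_eq_preimage_symm B).symm
  have hind : (fun y => ENNReal.ofReal ((Icc (0 : ℝ) 1).indicator e' y)) =
      (Icc (0 : ℝ) 1).indicator fun y => ENNReal.ofReal (e' y) := by
    ext y
    by_cases hy : y ∈ Icc (0 : ℝ) 1 <;> simp [hy]
  rw [Measure.restrict_apply (e.symm.continuous.measurable hB), hpre, hind,
    setLIntegral_indicator measurableSet_Icc]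
  exact (lintegral_deriv_eq_volume_image_of_monotoneOn (measurableSet_Icc.inter hB)
    (fun x _ => (he x).hasDerivWithinAt) (e.monotone.monotoneOn _)).symm

/-- The perturbation `y ↦ y + sin (c y) / (2 c)` of the identity is an increasing bijection of `ℝ`
with a continuous derivative bounded away from zero. -/
theorem exists_orderIso_add_sin {c : ℝ} (hc : 0 < c) :
    ∃ e : ℝ ≃o ℝ, (∀ y, e y = y + Real.sin (c * y) / (2 * c)) ∧
      ∀ y, HasDerivAt e (1 + Real.cos (c * y) / 2) y := by
  set h : ℝ → ℝ := fun y => y + Real.sin (c * y) / (2 * c) with hh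
  have hd (y : ℝ) : HasDerivAt h (1 + Real.cos (c * y) / 2) y := by
    refine ((hasDerivAt_id y).add
      ((((hasDerivAt_id y).const_mul c).sin).div_const (2 * c))).congr_deriv ?_
    simp only [id]
    field_simp
  have hcont : Continuous h := by fun_prop
  have hmono : StrictMono h := strictMono_of_hasDerivAt_pos hd fun y => by
    linarith [Real.neg_one_le_cos (c * y)]
  have hbound (y : ℝ) : |Real.sin (c * y) / (2 * c)| ≤ 1 / (2 * c) := by
    rw [abs_div, abs_of_pos (by positivity : 0 < 2 * c)]
    gcongr
    exact Real.abs_sin_le_one _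
  have hsurj : Function.Surjective h := by
    refine hcont.surjective ?_ ?_
    · refine Filter.tendsto_atTop_mono (f := fun y => y + -(1 / (2 * c)))
        (fun y => ?_) (Filter.tendsto_atTop_add_const_right _ _ Filter.tendsto_id)
      simp only [hh]
      linarith [(abs_le.1 (hbound y)).1]
    · refine Filter.tendsto_atBot_mono (f := fun y => y + 1 / (2 * c))
        (fun y => ?_) (Filter.tendsto_atBot_add_const_right _ _ Filter.tendsto_id)
      simp only [hh]
      linarith [(abs_le.1 (hbound y)).2]
  exact ⟨hmono.orderIsoOfSurjective h hsurj, fun _ => rfl, hd⟩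

/-- Closeness in the supremum norm does not imply closeness of the induced
densities: for every `ε > 0` there are strictly increasing `C¹` functions `f, g` on `[0,1]`
with `‖f - g‖_∞ ≤ ε` whose induced PDFs (under Lebesgue measure on `[0,1]`), continuous on the
interior of the respective ranges, differ somewhere by at least `1/2`. -/
theorem sup_close_but_pdf_far (ε : ℝ) (hε : 0 < ε) :
    ∃ f g pf pg : ℝ → ℝ,
      StrictMonoOn f (Icc 0 1) ∧ StrictMonoOn g (Icc 0 1) ∧
      ContDiffOn ℝ 1 f (Icc 0 1) ∧ ContDiffOn ℝ 1 g (Icc 0 1) ∧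
      (∀ α ∈ Icc (0:ℝ) 1, |f α - g α| ≤ ε) ∧
      ContinuousOn pf (Ioo (f 0) (f 1)) ∧ ContinuousOn pg (Ioo (g 0) (g 1)) ∧
      (∀ B : Set ℝ, MeasurableSet B →
        (volume.restrict (Icc (0:ℝ) 1)) (f ⁻¹' B) = ∫⁻ y in B, ENNReal.ofReal (pf y)) ∧
      (∀ B : Set ℝ, MeasurableSet B →
        (volume.restrict (Icc (0:ℝ) 1)) (g ⁻¹' B) = ∫⁻ y in B, ENNReal.ofReal (pg y)) ∧
      ∃ y ∈ Ioo (f 0) (f 1) ∩ Ioo (g 0) (g 1), 1 / 2 ≤ |pf y - pg y| := by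
  obtain ⟨m, hm⟩ := exists_nat_gt (1 / ε)
  set n : ℝ := m + 2 with hn
  have hn2 : 2 ≤ n := by simp [hn]
  have hnpos : 0 < n := by linarith
  set c : ℝ := 2 * Real.pi * n with hcdef
  have hc : 0 < c := by positivity
  have hnc : 1 / ε ≤ 2 * c := by nlinarith [Real.pi_gt_three]
  obtain ⟨e, he, hd⟩ := exists_orderIso_add_sin hc
  have h0 : e 0 = 0 := by simp [he]
  have h1 : e 1 = 1 := by
    have : Real.sin (c * 1) = 0 := by
      convert Real.sin_nat_mul_pi (2 * (m + 2)) using 2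
      push_cast
      ring
    rw [he, this]
    simp
  have hs0 : e.symm 0 = 0 := by rw [e.symm_apply_eq, h0]
  have hs1 : e.symm 1 = 1 := by rw [e.symm_apply_eq, h1]
  have hsmooth : ContDiff ℝ 1 e.symm := by
    refine e.toHomeomorph.contDiff_symm_deriv (f' := fun y => 1 + Real.cos (c * y) / 2)
      (fun y => ?_) hd ?_
    · linarith [Real.neg_one_le_cos (c * y)]
    · rw [show (e.toHomeomorph : ℝ → ℝ) = fun y => y + Real.sin (c * y) / (2 * c) from funext he]
      fun_prop
  refine ⟨id, e.symm, (Icc 0 1).indicator fun _ => 1,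
    (Icc 0 1).indicator fun y => 1 + Real.cos (c * y) / 2, strictMonoOn_id,
    e.symm.strictMono.strictMonoOn _, contDiffOn_id, hsmooth.contDiffOn, fun α _ => ?_, ?_, ?_,
    fun B hB => (OrderIso.refl ℝ).volume_restrict_Icc_preimage_symm (fun x => hasDerivAt_id x)
      rfl rfl hB,
    fun B hB => e.volume_restrict_Icc_preimage_symm hd h0 h1 hB, n⁻¹, ?_, ?_⟩
  · obtain ⟨y, rfl⟩ := e.surjective α
    have hy : e y - y = Real.sin (c * y) / (2 * c) := by rw [he]; ring
    rw [id, e.symm_apply_apply, hy, abs_div, abs_of_pos (by positivity : 0 < 2 * c),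
      div_le_iff₀ (by positivity)]
    refine (Real.abs_sin_le_one _).trans ?_
    rwa [div_le_iff₀' hε] at hnc
  · exact continuousOn_const.congr fun y hy => indicator_of_mem (Ioo_subset_Icc_self hy) _
  · rw [hs0, hs1]
    have hcont : Continuous fun y => 1 + Real.cos (c * y) / 2 := by fun_prop
    exact hcont.continuousOn.congr fun y hy => indicator_of_mem (Ioo_subset_Icc_self hy) _
  · rw [hs0, hs1, id, id, inter_self]
    exact ⟨by positivity, inv_lt_one_of_one_lt₀ (by linarith)⟩
  · have hmem : n⁻¹ ∈ Icc (0 : ℝ) 1 := ⟨by positivity, inv_le_one_of_one_le₀ (by linarith)⟩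
    have hcn : c * n⁻¹ = 2 * Real.pi := by
      rw [hcdef]
      field_simp
    rw [indicator_of_mem hmem, indicator_of_mem hmem, hcn, Real.cos_two_pi]
    norm_num
end

section
/- Let b > 0 and let f, s : [α_min, α_max] → ℝ be continuous, with s differentiable and s′(α) ≥ b for every α ∈ [α_min, α_max], and suppose the range of f is contained in the range of s. Then for every α ∈ [α_min, α_max], |s⁻¹(f(α)) − α| ≤ (1/b) · sup_{β ∈ [α_min, α_max]} |f(β) − s(β)|, where s⁻¹ denotes the inverse function of s (which exists since s is strictly increasing). -/
open Set

/-- If `s` has derivative at least `b` on `[l, u]`, then `s` expands distances by a factor at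
least `b` there. -/
theorem mul_abs_sub_le_abs_image_sub_of_le_hasDerivWithinAt {l u b : ℝ} {s s' : ℝ → ℝ}
    (hs : ∀ x ∈ Icc l u, HasDerivWithinAt s (s' x) (Icc l u) x)
    (hb : ∀ x ∈ Icc l u, b ≤ s' x) {x y : ℝ} (hx : x ∈ Icc l u) (hy : y ∈ Icc l u) :
    b * |x - y| ≤ |s x - s y| := by
  have hderiv : ∀ z ∈ interior (Icc l u), HasDerivAt s (s' z) z := fun z hz =>
    (hs z (interior_subset hz)).hasDerivAt (mem_interior_iff_mem_nhds.mp hz)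
  have key : ∀ v ∈ Icc l u, ∀ w ∈ Icc l u, v ≤ w → b * (w - v) ≤ s w - s v :=
    (convex_Icc l u).mul_sub_le_image_sub_of_le_deriv
      (fun z hz => (hs z hz).continuousWithinAt)
      (fun z hz => (hderiv z hz).differentiableAt.differentiableWithinAt)
      (fun z hz => (hderiv z hz).deriv ▸ hb z (interior_subset hz))
  rcases le_total x y with h | h
  · rw [abs_sub_comm x y, abs_sub_comm (s x), abs_of_nonneg (sub_nonneg.2 h)]
    exact (key x hx y hy h).trans (le_abs_self _)
  · rw [abs_of_nonneg (sub_nonneg.2 h)]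
    exact (key y hy x hx h).trans (le_abs_self _)

/-- quantitative inverse-function estimate. If `s` approximates `f` and
`s' ≥ b > 0`, then the point `s⁻¹(f(α))` where `s` attains the value `f(α)` is within
`(1/b)·‖f - s‖_∞` of `α`. -/
theorem inv_comp_dist_le
    (αmin αmax b : ℝ) (hle : αmin ≤ αmax) (hb : 0 < b)
    (f s s' sinv : ℝ → ℝ)
    (hfc : ContinuousOn f (Icc αmin αmax))
    (hsc : ContinuousOn s (Icc αmin αmax))
    (hs : ∀ α ∈ Icc αmin αmax, HasDerivWithinAt s (s' α) (Icc αmin αmax) α)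
    (hs'b : ∀ α ∈ Icc αmin αmax, b ≤ s' α)
    (hrange : f '' Icc αmin αmax ⊆ s '' Icc αmin αmax)
    (hsinv : ∀ y ∈ s '' Icc αmin αmax, sinv y ∈ Icc αmin αmax ∧ s (sinv y) = y) :
    ∀ α ∈ Icc αmin αmax,
      |sinv (f α) - α| ≤ (1 / b) * sSup ((fun β => |f β - s β|) '' Icc αmin αmax) := by
  intro α hα
  obtain ⟨hmem, heq⟩ := hsinv (f α) (hrange (mem_image_of_mem f hα))
  have hexp := mul_abs_sub_le_abs_image_sub_of_le_hasDerivWithinAt hs hs'b hmem hα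
  rw [heq] at hexp
  have hsup : |f α - s α| ≤ sSup ((fun β => |f β - s β|) '' Icc αmin αmax) :=
    le_csSup (isCompact_Icc.bddAbove_image (hfc.sub hsc).abs) (mem_image_of_mem _ hα)
  rw [one_div, ← div_eq_inv_mul, le_div_iff₀' hb]
  exact hexp.trans hsup
end

section
/- Let f : ℝ → ℝ be twice continuously differentiable with |f″(ξ)| ≤ M₂ for all ξ, where M₂ > 0, let α₀ ∈ ℝ, and let κ > 0 satisfy f′(α₀) ≥ κ. Set ξ_max := κ/(2M₂). Then: (i) f′(ξ) ≥ κ/2 for every ξ ∈ [α₀ − ξ_max, α₀ + ξ_max]; and (ii) for every y ∈ ℝ with |y − f(α₀)| ≤ (κ/2)·ξ_max there exists δ ∈ ℝ with |δ| ≤ ξ_max such that f(α₀ + δ) = y, and moreover |δ| ≤ 2·|y − f(α₀)|/κ. -/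
open Set

/-- quantitative solvability along a line. If `f` is `C²` with
`|f''| ≤ M₂`, `f'(α₀) ≥ κ > 0`, and `ξ_max = κ/(2M₂)`, then `f' ≥ κ/2` on
`[α₀ - ξ_max, α₀ + ξ_max]`, and every `y` with `|y - f(α₀)| ≤ (κ/2)·ξ_max` is attained as
`y = f(α₀ + δ)` with `|δ| ≤ ξ_max` and `|δ| ≤ 2|y - f(α₀)|/κ`. -/
theorem solvability_along_line
    (f : ℝ → ℝ) (hf : ContDiff ℝ 2 f)
    (M₂ : ℝ) (hM₂ : 0 < M₂)
    (hf'' : ∀ ξ : ℝ, |deriv (deriv f) ξ| ≤ M₂)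
    (α₀ κ : ℝ) (hκ : 0 < κ) (hκ' : κ ≤ deriv f α₀)
    (ξmax : ℝ) (hξ : ξmax = κ / (2 * M₂)) :
    (∀ ξ ∈ Icc (α₀ - ξmax) (α₀ + ξmax), κ / 2 ≤ deriv f ξ) ∧
    (∀ y : ℝ, |y - f α₀| ≤ (κ / 2) * ξmax →
      ∃ δ : ℝ, |δ| ≤ ξmax ∧ f (α₀ + δ) = y ∧ |δ| ≤ 2 * |y - f α₀| / κ) := by
  have hdf : Differentiable ℝ f := hf.differentiable (by norm_num)
  have hddf : Differentiable ℝ (deriv f) :=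
    (hf.iterate_deriv' 1 1).differentiable (by norm_num)
  have hMξ : M₂ * ξmax = κ / 2 := by
    rw [hξ]; field_simp
  have hderiv : ∀ ξ ∈ Icc (α₀ - ξmax) (α₀ + ξmax), κ / 2 ≤ deriv f ξ := by
    intro ξ hmem
    have hlip : |deriv f ξ - deriv f α₀| ≤ M₂ * |ξ - α₀| :=
      convex_univ.norm_image_sub_le_of_norm_deriv_le (fun x _ => hddf x)
        (fun x _ => hf'' x) (mem_univ α₀) (mem_univ ξ)
    have hdist : |ξ - α₀| ≤ ξmax := abs_le.2 ⟨by linarith [hmem.1], by linarith [hmem.2]⟩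
    have hbound := mul_le_mul_of_nonneg_left hdist hM₂.le
    linarith [(abs_le.1 hlip).1]
  refine ⟨hderiv, fun y hy => ?_⟩
  set r := 2 * |y - f α₀| / κ with hr
  have hr0 : 0 ≤ r := by positivity
  have hκr : κ / 2 * r = |y - f α₀| := by
    rw [hr]; field_simp
  have hrξ : r ≤ ξmax := by
    rw [← hκr] at hy
    exact le_of_mul_le_mul_left hy (by positivity)
  have hgrowth := (convex_Icc (α₀ - ξmax) (α₀ + ξmax)).mul_sub_le_image_sub_of_le_deriv
    hdf.continuous.continuousOn hdf.differentiableOn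
    (fun x hx => hderiv x (interior_subset hx))
  have hright := hgrowth α₀ ⟨by linarith, by linarith⟩ (α₀ + r)
    ⟨by linarith, by linarith⟩ (by linarith)
  have hleft := hgrowth (α₀ - r) ⟨by linarith, by linarith⟩ α₀
    ⟨by linarith, by linarith⟩ (by linarith)
  rw [add_sub_cancel_left, hκr] at hright
  rw [sub_sub_cancel, hκr] at hleft
  obtain ⟨x, hx, hfx⟩ := intermediate_value_Icc (by linarith : α₀ - r ≤ α₀ + r)
    hdf.continuous.continuousOn
    (show y ∈ Icc (f (α₀ - r)) (f (α₀ + r)) from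
      ⟨by linarith [neg_abs_le (y - f α₀)], by linarith [le_abs_self (y - f α₀)]⟩)
  have hδ : |x - α₀| ≤ r := abs_le.2 ⟨by linarith [hx.1], by linarith [hx.2]⟩
  exact ⟨x - α₀, hδ.trans hrξ, by rwa [add_sub_cancel], hδ⟩
end
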